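/- There is a bijection between W_0 and the product of the set of (k+1)-tuples (p_0, …, p_k) of nonnegative integers summing to n with the set of k-tuples (q_1, …, q_k) of nonnegative integers summing to n − k, given by sending w to its sequences of p- and q-statistics. -/

import Mathlib

inductive Letter : Type
  | R | U | D
deriving DecidableEq

section Stats

open Letter

/-- The numbers of non-`U` letters in the blocks cut out by the letters `U`. -/
def pStats (w : List Letter) : List ℕ := (w.splitOn U).map List.length

/-- The numbers of letters `D` in the blocks cut out by the letters `R`. -/
def qStats (w : List Letter) : List ℕ := (w.splitOn R).map (fun s => s.count D)

theorem map_modifyHead_of_comp {α β : Type*} {f : α → β} {g : α → α} {h : β → β}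
    (hfg : ∀ a, f (g a) = h (f a)) (l : List α) :
    (l.modifyHead g).map f = (l.map f).modifyHead h := by
  cases l <;> simp [hfg]

@[simp] theorem pStats_nil : pStats [] = [0] := by simp [pStats]

@[simp] theorem pStats_cons_U (w : List Letter) : pStats (U :: w) = 0 :: pStats w := by
  simp [pStats, List.splitOn, List.splitOnP_cons_eq_if_modifyHead]

theorem pStats_cons_of_ne {x : Letter} (hx : x ≠ U) (w : List Letter) :
    pStats (x :: w) = (pStats w).modifyHead (· + 1) := by
  simp only [pStats, List.splitOn, List.splitOnP_cons_eq_if_modifyHead, beq_iff_eq, hx, if_false]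
  exact map_modifyHead_of_comp (by simp) _

@[simp] theorem pStats_cons_R (w : List Letter) :
    pStats (R :: w) = (pStats w).modifyHead (· + 1) := pStats_cons_of_ne (by decide) w

@[simp] theorem pStats_cons_D (w : List Letter) :
    pStats (D :: w) = (pStats w).modifyHead (· + 1) := pStats_cons_of_ne (by decide) w

@[simp] theorem qStats_nil : qStats [] = [0] := by simp [qStats]

@[simp] theorem qStats_cons_R (w : List Letter) : qStats (R :: w) = 0 :: qStats w := by
  simp [qStats, List.splitOn, List.splitOnP_cons_eq_if_modifyHead]

@[simp] theorem qStats_cons_D (w : List Letter) :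
    qStats (D :: w) = (qStats w).modifyHead (· + 1) := by
  simp only [qStats, List.splitOn, List.splitOnP_cons_eq_if_modifyHead, beq_iff_eq, reduceCtorEq, if_false]
  exact map_modifyHead_of_comp (by simp) _

@[simp] theorem qStats_cons_U (w : List Letter) : qStats (U :: w) = qStats w := by
  simp only [qStats, List.splitOn, List.splitOnP_cons_eq_if_modifyHead, beq_iff_eq, reduceCtorEq, if_false]
  rw [map_modifyHead_of_comp (h := id) (by simp)]
  simp

theorem exists_pStats_eq_cons (w : List Letter) : ∃ a p, pStats w = a :: p := by
  induction w with
  | nil => simp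
  | cons x w ih => obtain ⟨a, p, h⟩ := ih; cases x <;> simp [h]

theorem exists_qStats_eq_cons (w : List Letter) : ∃ b q, qStats w = b :: q := by
  induction w with
  | nil => simp
  | cons x w ih => obtain ⟨b, q, h⟩ := ih; cases x <;> simp [h]

theorem length_pStats (w : List Letter) : (pStats w).length = w.count U + 1 := by
  induction w with
  | nil => simp
  | cons x w ih => cases x <;> simp [ih]

theorem length_qStats (w : List Letter) : (qStats w).length = w.count R + 1 := by
  induction w with
  | nil => simp
  | cons x w ih => cases x <;> simp [ih]

theorem sum_pStats (w : List Letter) : (pStats w).sum = w.count R + w.count D := by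
  induction w with
  | nil => simp
  | cons x w ih =>
    obtain ⟨a, p, h⟩ := exists_pStats_eq_cons w
    cases x <;> simp_all <;> omega

theorem sum_qStats (w : List Letter) : (qStats w).sum = w.count D := by
  induction w with
  | nil => simp
  | cons x w ih =>
    obtain ⟨b, q, h⟩ := exists_qStats_eq_cons w
    cases x <;> simp_all
    omega

/-- The head of `qStats w` counts the letters `D` that precede every `R`. -/
theorem exists_D_before_R_iff (w : List Letter) :
    (∃ u v : List Letter, w = u ++ D :: v ∧ R ∉ u) ↔ (qStats w).headI ≠ 0 := by
  induction w with
  | nil => simp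
  | cons x w ih =>
    obtain ⟨b, q, h⟩ := exists_qStats_eq_cons w
    cases x with
    | R =>
      simp only [qStats_cons_R, List.headI_cons, ne_eq, not_true_eq_false, iff_false]
      rintro ⟨_ | ⟨y, u⟩, v, h, hu⟩
      · simp at h
      · simp_all
    | D =>
      simp only [qStats_cons_D, h, List.modifyHead_cons, List.headI_cons, ne_eq,
        Nat.add_eq_zero_iff, one_ne_zero, and_false, not_false_eq_true, iff_true]
      exact ⟨[], w, rfl, by simp⟩
    | U =>
      rw [qStats_cons_U, ← ih]
      constructor
      · rintro ⟨_ | ⟨y, u⟩, v, h, hu⟩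
        · simp at h
        · simp only [List.cons_append, List.cons.injEq] at h
          exact ⟨u, v, h.2, fun hR => hu (List.mem_cons_of_mem _ hR)⟩
      · rintro ⟨u, v, rfl, hu⟩
        exact ⟨U :: u, v, rfl, by simpa using hu⟩

theorem eq_of_stats_eq {w w' : List Letter} (hp : pStats w = pStats w')
    (hq : qStats w = qStats w') : w = w' := by
  induction w generalizing w' with
  | nil =>
    cases w' with
    | nil => rfl
    | cons y w' =>
      obtain ⟨a, p, h⟩ := exists_pStats_eq_cons w'
      cases y <;> simp_all
  | cons x w ih =>
    obtain ⟨a, p, h⟩ := exists_pStats_eq_cons w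
    obtain ⟨b, q, h'⟩ := exists_qStats_eq_cons w
    cases w' with
    | nil => cases x <;> simp_all
    | cons y w' =>
      obtain ⟨c, r, hc⟩ := exists_pStats_eq_cons w'
      obtain ⟨d, s, hd⟩ := exists_qStats_eq_cons w'
      have key := @ih w'
      cases x <;> cases y <;> simp_all

theorem exists_stats_eq (a : ℕ) (p : List ℕ) (b : ℕ) (q : List ℕ)
    (h : (a :: p).sum = (b :: q).sum + q.length) :
    ∃ w, pStats w = a :: p ∧ qStats w = b :: q := by
  match a, p, b, q with
  | 0, [], b, q =>
    refine ⟨[], ?_⟩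
    cases q <;> simp_all
  | 0, c :: p, b, q =>
    obtain ⟨w, hp, hq⟩ := exists_stats_eq c p b q (by simpa using h)
    exact ⟨U :: w, by simp [hp, hq]⟩
  | a + 1, p, b + 1, q =>
    obtain ⟨w, hp, hq⟩ := exists_stats_eq a p b q (by simp at h ⊢; omega)
    exact ⟨D :: w, by simp [hp, hq]⟩
  | a + 1, p, 0, [] => simp at h
  | a + 1, p, 0, c :: q =>
    obtain ⟨w, hp, hq⟩ := exists_stats_eq a p c q (by simp at h ⊢; omega)
    exact ⟨R :: w, by simp [hp, hq]⟩
termination_by a + p.sum + p.length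

theorem List.ofFn_getD_eq {α : Type*} {m : ℕ} {l : List α} (hl : l.length = m) (d : α) :
    List.ofFn (fun i : Fin m => l.getD i.val d) = l := by
  subst hl
  simp

theorem List.getD_ofFn_val {α : Type*} {m : ℕ} (f : Fin m → α) (d : α) (i : Fin m) :
    (List.ofFn f).getD i.val d = f i := by
  simp

theorem qStats_eq_zero_cons {w : List Letter} {k : ℕ} (hR : w.count R = k)
    (hD : ¬ ∃ u v : List Letter, w = u ++ D :: v ∧ R ∉ u) :
    qStats w = 0 :: List.ofFn (fun i : Fin k => (qStats w).getD (i.val + 1) 0) := by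
  rw [exists_D_before_R_iff, not_not] at hD
  obtain ⟨b, q, h⟩ := exists_qStats_eq_cons w
  have hl := length_qStats w
  simp only [h, List.headI_cons, List.length_cons, hR, Nat.add_right_cancel_iff,
    List.getD_cons_succ] at hD hl ⊢
  rw [List.ofFn_getD_eq hl, hD]

end Stats

open Letter in
/-- The map sending a word `w ∈ W_0` to its sequences of `p`- and `q`-statistics is a
bijection from `W_0` onto the product of the set of `(k+1)`-tuples `(p_0, …, p_k)` of
nonnegative integers summing to `n` with the set of `k`-tuples `(q_1, …, q_k)` of
nonnegative integers summing to `n - k`. -/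
theorem stmt_10 (n k : ℕ) (hk : 1 ≤ k) (hkn : k ≤ n) :
    Set.BijOn
      (fun w : List Letter =>
        ((fun i : Fin (k + 1) => ((w.splitOn U).map List.length).getD i.val 0,
          fun i : Fin k =>
            ((w.splitOn R).map (fun s => s.count D)).getD (i.val + 1) 0) :
          (Fin (k + 1) → ℕ) × (Fin k → ℕ)))
      {w : List Letter |
        w.count R = k ∧ w.count U = k ∧ w.count D = n - k ∧
        w.head? ≠ some D ∧ ¬ (∃ u v : List Letter, w = u ++ D :: v ∧ R ∉ u)}
      {pq : (Fin (k + 1) → ℕ) × (Fin k → ℕ) |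
        (∑ i, pq.1 i) = n ∧ (∑ i, pq.2 i) = n - k} := by
  change Set.BijOn (fun w : List Letter =>
    ((fun i : Fin (k + 1) => (pStats w).getD i.val 0,
      fun i : Fin k => (qStats w).getD (i.val + 1) 0) :
      (Fin (k + 1) → ℕ) × (Fin k → ℕ))) _ _
  refine ⟨?_, ?_, ?_⟩
  · rintro w ⟨hR, hU, hD, -, hw⟩
    have hp := List.ofFn_getD_eq ((length_pStats w).trans (by rw [hU])) 0
    have hq := congrArg List.sum (qStats_eq_zero_cons hR hw)
    rw [List.sum_cons, zero_add, sum_qStats, List.sum_ofFn] at hq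
    have hp' := congrArg List.sum hp
    rw [sum_pStats, List.sum_ofFn] at hp'
    exact ⟨by dsimp only; omega, by dsimp only; omega⟩
  · rintro w ⟨hR, hU, -, -, hw⟩ w' ⟨hR', hU', -, -, hw'⟩ heq
    obtain ⟨hp, hq⟩ := Prod.ext_iff.mp heq
    dsimp only at hp hq
    apply eq_of_stats_eq
    · rw [← List.ofFn_getD_eq ((length_pStats w).trans (by rw [hU])) 0, hp,
        List.ofFn_getD_eq ((length_pStats w').trans (by rw [hU'])) 0]
    · rw [qStats_eq_zero_cons hR hw, hq, ← qStats_eq_zero_cons hR' hw']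
  · rintro ⟨p, q⟩ ⟨hp, hq⟩
    dsimp only at hp hq
    obtain ⟨w, hwp, hwq⟩ := exists_stats_eq (p 0) (List.ofFn fun i => p (Fin.succ i)) 0
      (List.ofFn q) (by
        rw [← List.ofFn_succ, List.sum_ofFn, List.sum_cons, List.sum_ofFn, List.length_ofFn]
        omega)
    rw [← List.ofFn_succ] at hwp
    have hR := length_qStats w
    have hU := length_pStats w
    have hD := sum_qStats w
    rw [hwq, List.length_cons, List.length_ofFn] at hR
    rw [hwp, List.length_ofFn] at hU
    rw [hwq, List.sum_cons, List.sum_ofFn] at hD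
    have hw : ¬ ∃ u v : List Letter, w = u ++ D :: v ∧ R ∉ u := by
      rw [exists_D_before_R_iff, hwq]
      simp
    refine ⟨w, ⟨by omega, by omega, by omega, fun h => hw ?_, hw⟩, ?_⟩
    · obtain ⟨v, hv⟩ := List.head?_eq_some_iff.mp h
      exact ⟨[], v, hv, by simp⟩
    · ext i
      · simp only [hwp, List.getD_ofFn_val]
      · simp only [hwq, List.getD_cons_succ, List.getD_ofFn_val]
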